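/- Let G = (V,D,B) be an acyclic mixed graph with mixed components G_1, …, G_k. Then G is generically infinite-to-one (the fiber φ_G^{-1}({φ_G(Λ,Ω)}) is infinite for all (Λ,Ω) outside a proper algebraic subset of Θ_G) if and only if some mixed component G_j is generically infinite-to-one. -/

import Mathlib

open scoped Classical Matrix

/-- The directed part of the graph contains no directed cycle. -/
def Acyclic {n : ℕ} (D : Finset (Fin n × Fin n)) : Prop :=
  ∀ v : Fin n, ¬ Relation.TransGen (fun a b => (a, b) ∈ D) v v

/-- Mixed graph axioms: the bidirected edge set is symmetric and there are no self loops. -/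
def IsMixedGraph {n : ℕ} (D B : Finset (Fin n × Fin n)) : Prop :=
  (∀ v w : Fin n, (v, w) ∈ B → (w, v) ∈ B) ∧ ∀ v : Fin n, (v, v) ∉ D ∧ (v, v) ∉ B

/-- `IsTrek D B v w L R`: `L` is the left side of a trek from `v` to `w`, listed from the top
node down to the source `v` (consecutive vertices joined by directed edges pointing towards
`v`); `R` is the right side, listed from the top down to the target `w`.  Either the two tops
coincide (no bidirected edge) or they are joined by a bidirected edge. -/
def IsTrek {n : ℕ} (D B : Finset (Fin n × Fin n)) (v w : Fin n)
    (L R : List (Fin n)) : Prop :=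
  L ≠ [] ∧ R ≠ [] ∧
    L.Chain' (fun a b => (a, b) ∈ D) ∧ R.Chain' (fun a b => (a, b) ∈ D) ∧
    L.getLast? = some v ∧ R.getLast? = some w ∧
    (L.head? = R.head? ∨
      ∃ u z : Fin n, L.head? = some u ∧ R.head? = some z ∧ (u, z) ∈ B)

/-- Product of the matrix entries `Λ x y` over the consecutive pairs `(x, y)` of a list,
i.e. the product of the directed-edge coefficients along a directed path. -/
noncomputable def edgeProd {n : ℕ} (Λ : Matrix (Fin n) (Fin n) ℝ) :
    List (Fin n) → ℝ
  | [] => 1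
  | [_] => 1
  | x :: y :: rest => Λ x y * edgeProd Λ (y :: rest)

/-- The trek monomial of the trek with sides `L`, `R`. -/
noncomputable def trekWeight {n : ℕ} (Λ Ω : Matrix (Fin n) (Fin n) ℝ)
    (L R : List (Fin n)) : ℝ :=
  (match L.head?, R.head? with
    | some u, some z => Ω u z
    | _, _ => 0) * edgeProd Λ L * edgeProd Λ R

/-- `u` is an ancestor of `v`: there is a (possibly empty) directed path from `u` to `v`. -/
def IsAncestor {n : ℕ} (D : Finset (Fin n × Fin n)) (u v : Fin n) : Prop :=
  Relation.ReflTransGen (fun a b => (a, b) ∈ D) u v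

/-- `V'` is an ancestral subset: it contains all ancestors of its members. -/
def Ancestral {n : ℕ} (D : Finset (Fin n × Fin n)) (V' : Finset (Fin n)) : Prop :=
  ∀ u v : Fin n, IsAncestor D u v → v ∈ V' → u ∈ V'

/-- The parents of `v`. -/
def paF {n : ℕ} (D : Finset (Fin n × Fin n)) (v : Fin n) : Finset (Fin n) :=
  Finset.univ.filter fun w => (w, v) ∈ D

/-- `htr D B v`: the set of vertices `w ∉ {v} ∪ sib(v)` reachable from `v` by a half-trek. -/
def htr {n : ℕ} (D B : Finset (Fin n × Fin n)) (v : Fin n) : Set (Fin n) :=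
  {w | w ≠ v ∧ (v, w) ∉ B ∧ ∃ R, IsTrek D B v w [v] R}

/-- `Y` satisfies the half-trek criterion with respect to `v`: `|Y| = |pa(v)|`,
`Y ∩ ({v} ∪ sib(v)) = ∅`, and there is a system of half-treks with no sided intersection
from `Y` to `pa(v)` (given by a source `src p ∈ Y` and a right side `R p` for each parent
`p`, with pairwise distinct sources and pairwise disjoint right sides). -/
def SatisfiesHTC {n : ℕ} (D B : Finset (Fin n × Fin n)) (v : Fin n)
    (Y : Finset (Fin n)) : Prop :=
  Y.card = (paF D v).card ∧
    (∀ y ∈ Y, y ≠ v ∧ (y, v) ∉ B) ∧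
    ∃ (src : Fin n → Fin n) (R : Fin n → List (Fin n)),
      (∀ p ∈ paF D v, src p ∈ Y ∧ IsTrek D B (src p) p [src p] (R p)) ∧
      ∀ p ∈ paF D v, ∀ q ∈ paF D v, p ≠ q →
        src p ≠ src q ∧ ∀ x ∈ R p, x ∉ R q

/-- The parameter space `Θ = ℝ^D × PD(B)`. -/
def Theta {α : Type} [Fintype α] (D B : Set (α × α)) :
    Set (Matrix α α ℝ × Matrix α α ℝ) :=
  {p : Matrix α α ℝ × Matrix α α ℝ |
    (∀ v w : α, p.1 v w ≠ 0 → (v, w) ∈ D) ∧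
      p.2.PosDef ∧ ∀ v w : α, v ≠ w → p.2 v w ≠ 0 → (v, w) ∈ B}

/-- The parameterization map `φ(Λ, Ω) = (I - Λ)⁻ᵀ Ω (I - Λ)⁻¹`. -/
noncomputable def phi {α : Type} [Fintype α] [DecidableEq α]
    (p : Matrix α α ℝ × Matrix α α ℝ) : Matrix α α ℝ :=
  ((1 - p.1)⁻¹)ᵀ * p.2 * (1 - p.1)⁻¹

/-- Evaluation of a polynomial in the entries of the two parameter matrices. -/
noncomputable def polyEval {α : Type} [Fintype α]
    (f : MvPolynomial ((α × α) ⊕ (α × α)) ℝ)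
    (p : Matrix α α ℝ × Matrix α α ℝ) : ℝ :=
  MvPolynomial.eval (Sum.elim (fun e => p.1 e.1 e.2) (fun e => p.2 e.1 e.2)) f

/-- `A` is a proper algebraic subset of `Θ`: the intersection of `Θ` with the zero set of a
polynomial in the matrix entries that does not vanish identically on `Θ`. -/
def IsProperAlg {α : Type} [Fintype α]
    (Θ A : Set (Matrix α α ℝ × Matrix α α ℝ)) : Prop :=
  ∃ f : MvPolynomial ((α × α) ⊕ (α × α)) ℝ,
    (∃ p ∈ Θ, polyEval f p ≠ 0) ∧ A = {p ∈ Θ | polyEval f p = 0}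

/-- Generic identifiability: `φ` is injective off a proper algebraic subset. -/
def GenId {α : Type} [Fintype α] [DecidableEq α] (D B : Set (α × α)) : Prop :=
  ∃ A, IsProperAlg (Theta D B) A ∧
    ∀ p ∈ Theta D B \ A, ∀ q ∈ Theta D B \ A, phi p = phi q → p = q

/-- Generic identifiability of the single coefficient `λ_{uv}`. -/
def GenIdLambda {α : Type} [Fintype α] [DecidableEq α] (D B : Set (α × α))
    (u v : α) : Prop :=
  ∃ A, IsProperAlg (Theta D B) A ∧
    ∀ p ∈ Theta D B \ A, ∀ q ∈ Theta D B \ A, phi p = phi q → p.1 u v = q.1 u v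

/-- Generic identifiability of the single coefficient `ω_{uv}`. -/
def GenIdOmega {α : Type} [Fintype α] [DecidableEq α] (D B : Set (α × α))
    (u v : α) : Prop :=
  ∃ A, IsProperAlg (Theta D B) A ∧
    ∀ p ∈ Theta D B \ A, ∀ q ∈ Theta D B \ A, phi p = phi q → p.2 u v = q.2 u v

/-- Generic identifiability of the coefficient vector `Λ_{pa(v), v}`. -/
def GenIdCol {α : Type} [Fintype α] [DecidableEq α] (D B : Set (α × α))
    (v : α) : Prop :=
  ∃ A, IsProperAlg (Theta D B) A ∧
    ∀ p ∈ Theta D B \ A, ∀ q ∈ Theta D B \ A, phi p = phi q →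
      ∀ u : α, (u, v) ∈ D → p.1 u v = q.1 u v

/-- The fiber of the parameter point `p` within `Θ`. -/
def fiber {α : Type} [Fintype α] [DecidableEq α] (D B : Set (α × α))
    (p : Matrix α α ℝ × Matrix α α ℝ) :
    Set (Matrix α α ℝ × Matrix α α ℝ) :=
  {q ∈ Theta D B | phi q = phi p}

/-- Generically infinite-to-one. -/
def GenInfToOne {α : Type} [Fintype α] [DecidableEq α] (D B : Set (α × α)) : Prop :=
  ∃ A, IsProperAlg (Theta D B) A ∧
    ∀ p ∈ Theta D B \ A, (fiber D B p).Infinite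

/-- Generically `h`-to-one: every fiber off a proper algebraic subset has exactly `h` points. -/
def GenHToOne {α : Type} [Fintype α] [DecidableEq α] (D B : Set (α × α))
    (h : ℕ) : Prop :=
  ∃ A, IsProperAlg (Theta D B) A ∧
    ∀ p ∈ Theta D B \ A, (fiber D B p).Finite ∧ (fiber D B p).ncard = h

/-- `w` lies in the connected component of `c` in the bidirected part `(V, B)`. -/
def bidirConn {n : ℕ} (B : Finset (Fin n × Fin n)) (c w : Fin n) : Prop :=
  Relation.ReflTransGen (fun a b => (a, b) ∈ B) c w

/-- The connected component `C` of `c` in the bidirected part. -/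
noncomputable def Cset {n : ℕ} (B : Finset (Fin n × Fin n)) (c : Fin n) :
    Finset (Fin n) :=
  Finset.univ.filter (bidirConn B c)

/-- The vertex set `V_i = C_i ∪ pa(C_i)` of the mixed component of `c`. -/
noncomputable def Vset {n : ℕ} (D B : Finset (Fin n × Fin n)) (c : Fin n) :
    Finset (Fin n) :=
  Cset B c ∪ Finset.univ.filter fun v => ∃ w ∈ Cset B c, (v, w) ∈ D

/-- The directed edges `D_i = {(v, w) ∈ D : v ∈ V_i, w ∈ C_i}` of the mixed component of `c`. -/
def compD {n : ℕ} (D B : Finset (Fin n × Fin n)) (c : Fin n) :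
    Set (↥(Vset D B c) × ↥(Vset D B c)) :=
  {e | ((e.1 : Fin n), (e.2 : Fin n)) ∈ D ∧ (e.2 : Fin n) ∈ Cset B c}

/-- The bidirected edges `B_i = {(v, w) ∈ B : v, w ∈ C_i}` of the mixed component of `c`. -/
def compB {n : ℕ} (D B : Finset (Fin n × Fin n)) (c : Fin n) :
    Set (↥(Vset D B c) × ↥(Vset D B c)) :=
  {e | ((e.1 : Fin n), (e.2 : Fin n)) ∈ B ∧ (e.1 : Fin n) ∈ Cset B c ∧
    (e.2 : Fin n) ∈ Cset B c}

/-- The edges of the induced subgraph `G_{V'}`, as pairs of vertices of the subtype `V'`. -/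
def inducedE {n : ℕ} (E : Finset (Fin n × Fin n)) (V' : Finset (Fin n)) :
    Set (↥V' × ↥V') :=
  {e | ((e.1 : Fin n), (e.2 : Fin n)) ∈ E}


/-- Unit upper triangular matrices with respect to a rank function `b`. -/
def UU {α : Type} (b : α → ℕ) (A : Matrix α α ℝ) : Prop :=
  (∀ i, A i i = 1) ∧ ∀ i j, i ≠ j → A i j ≠ 0 → b i < b j

section gen
set_option linter.unusedSectionVars false
variable {α : Type} [Fintype α] [DecidableEq α]

theorem UU.mul {b : α → ℕ} {A A' : Matrix α α ℝ} (h : UU b A) (h' : UU b A') :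
    UU b (A * A') := by
  constructor
  · intro i
    rw [Matrix.mul_apply, Finset.sum_eq_single i]
    · rw [h.1, h'.1, one_mul]
    · intro k _ hk
      by_contra hne
      have h1 := h.2 i k (Ne.symm hk) (left_ne_zero_of_mul hne)
      have h2 := h'.2 k i hk (right_ne_zero_of_mul hne)
      omega
    · simp
  · intro i j hij hne
    rw [Matrix.mul_apply] at hne
    obtain ⟨k, _, hk⟩ := Finset.exists_ne_zero_of_sum_ne_zero hne
    have h1 := h.2 i k
    have h2 := h'.2 k j
    have n1 := left_ne_zero_of_mul hk
    have n2 := right_ne_zero_of_mul hk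
    by_cases e1 : i = k
    · subst e1; exact h2 hij n2
    · by_cases e2 : k = j
      · subst e2; exact h1 hij n1
      · exact (h1 e1 n1).trans (h2 e2 n2)

theorem pow_strict {b : α → ℕ} {N : Matrix α α ℝ} (h : ∀ i j, N i j ≠ 0 → b i < b j)
    (k : ℕ) : ∀ i j, (N ^ k) i j ≠ 0 → b i + k ≤ b j := by
  induction k with
  | zero =>
    intro i j hne
    rw [pow_zero, Matrix.one_apply] at hne
    have : i = j := by by_contra h; simp [h] at hne
    subst this; simp
  | succ k ih =>
    intro i j hne
    rw [pow_succ, Matrix.mul_apply] at hne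
    obtain ⟨l, _, hl⟩ := Finset.exists_ne_zero_of_sum_ne_zero hne
    have h1 := ih i l (left_ne_zero_of_mul hl)
    have h2 := h l j (right_ne_zero_of_mul hl)
    omega

theorem UU.inv {b : α → ℕ} {A : Matrix α α ℝ} (h : UU b A) :
    UU b A⁻¹ ∧ A * A⁻¹ = 1 ∧ A⁻¹ * A = 1 := by
  set N := 1 - A with hN
  have hs : ∀ i j, N i j ≠ 0 → b i < b j := by
    intro i j hne
    by_cases e : i = j
    · subst e; simp [hN, h.1] at hne
    · apply h.2 i j e; simpa [hN, Matrix.one_apply, e] using hne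
  set m := Finset.univ.sup b + 1 with hm
  have hz : N ^ m = 0 := by
    ext i j
    by_contra hne
    have h1 := pow_strict hs m i j (by simpa using hne)
    have h2 : b j ≤ Finset.univ.sup b := Finset.le_sup (Finset.mem_univ j)
    omega
  have hA : A = 1 - N := by simp [hN]
  have hmul : A * (∑ k ∈ Finset.range m, N ^ k) = 1 := by
    rw [hA, mul_neg_geom_sum, hz, sub_zero]
  have hinv : A⁻¹ = ∑ k ∈ Finset.range m, N ^ k := Matrix.inv_eq_right_inv hmul
  refine ⟨?_, ?_, ?_⟩
  · rw [hinv]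
    have key : ∀ i j, (∑ k ∈ Finset.range m, N ^ k) i j
        = (1 : Matrix α α ℝ) i j + (∑ k ∈ Finset.range (m - 1), N ^ (k + 1)) i j := by
      intro i j
      have : m = (m - 1) + 1 := by omega
      rw [this, Finset.sum_range_succ']
      simp [Matrix.add_apply, add_comm]
    have key2 : ∀ i j, (∑ k ∈ Finset.range (m - 1), N ^ (k + 1)) i j ≠ 0 → b i < b j := by
      intro i j hne
      rw [Matrix.sum_apply] at hne
      obtain ⟨l, _, hl⟩ := Finset.exists_ne_zero_of_sum_ne_zero hne
      have := pow_strict hs _ i j hl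
      omega
    constructor
    · intro i
      rw [key]
      have : (∑ k ∈ Finset.range (m - 1), N ^ (k + 1)) i i = 0 := by
        by_contra hne
        exact absurd (key2 i i hne) (lt_irrefl _)
      simp [this]
    · intro i j hij hne
      rw [key] at hne
      apply key2
      simpa [Matrix.one_apply, hij] using hne
  · rw [hinv, hmul]
  · rw [hinv]; exact (mul_eq_one_comm).1 hmul

/-- A unipotent isometry of a positive definite form is the identity. -/
theorem unip_isom {b : α → ℕ} {K Ω : Matrix α α ℝ} (hK : UU b K) (hΩ : Ω.PosDef)
    (h : Kᵀ * Ω * K = Ω) : K = 1 := by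
  have main : ∀ m v, b v = m → ∀ i, K i v = (1 : Matrix α α ℝ) i v := by
    intro m
    induction m using Nat.strong_induction_on with
    | _ m ih =>
      intro v hv
      set x : α → ℝ := fun i => K i v - (1 : Matrix α α ℝ) i v with hx
      have hxs : ∀ u, x u ≠ 0 → b u < b v := by
        intro u hu
        by_cases e : u = v
        · subst e; simp [hx, hK.1] at hu
        · apply hK.2 u v e; simpa [hx, Matrix.one_apply, e] using hu
      have horth : ∀ u, b u < b v → (Ω *ᵥ x) u = 0 := by
        intro u hu
        have h1 := congrFun (congrFun h u) v
        have hKu : ∀ i, K i u = (1 : Matrix α α ℝ) i u := ih (b u) (hv ▸ hu) u rfl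
        rw [Matrix.mul_assoc, Matrix.mul_apply] at h1
        simp only [Matrix.transpose_apply, hKu, Matrix.one_apply, ite_mul, one_mul, zero_mul,
          Finset.sum_ite_eq', Finset.mem_univ, if_true] at h1
        have : (Ω *ᵥ x) u = (Ω * K) u v - (Ω * (1 : Matrix α α ℝ)) u v := by
          simp [Matrix.mulVec, dotProduct, hx, mul_sub, Matrix.mul_apply, Finset.sum_sub_distrib,
            Matrix.one_apply]
        rw [this, h1]; simp
      have hx0 : x = 0 := by
        by_contra hne
        have := hΩ.dotProduct_mulVec_pos hne
        have h0 : star x ⬝ᵥ (Ω *ᵥ x) = 0 := by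
          rw [dotProduct]
          apply Finset.sum_eq_zero
          intro u _
          by_cases e : x u = 0
          · simp [e]
          · rw [horth u (hxs u e), mul_zero]
        rw [h0] at this
        exact lt_irrefl _ this
      intro i
      have := congrFun hx0 i
      simp only [hx, Pi.zero_apply] at this
      linarith
  ext i j
  exact main _ j rfl i

/-- Replace the part of `p` belonging to `C` by that of `q`. -/
noncomputable def glue (C : Set α) (p q : Matrix α α ℝ × Matrix α α ℝ) :
    Matrix α α ℝ × Matrix α α ℝ :=
  (Matrix.of fun u v => if v ∈ C then q.1 u v else p.1 u v,
   Matrix.of fun u v => if u ∈ C ∧ v ∈ C then q.2 u v else p.2 u v)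

theorem glue_fst (C : Set α) (p q : Matrix α α ℝ × Matrix α α ℝ) (u v : α) :
    (glue C p q).1 u v = if v ∈ C then q.1 u v else p.1 u v := rfl

theorem glue_snd (C : Set α) (p q : Matrix α α ℝ × Matrix α α ℝ) (u v : α) :
    (glue C p q).2 u v = if u ∈ C ∧ v ∈ C then q.2 u v else p.2 u v := rfl

/-- Local fiber relation at `C`. -/
def RC (C : Set α) (p q : Matrix α α ℝ × Matrix α α ℝ) : Prop :=
  ∃ M : Matrix α α ℝ, (∀ u v, ¬ (u ∈ C ∧ v ∈ C) → M u v = (1 : Matrix α α ℝ) u v) ∧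
    (∀ v ∈ C, ∀ u, (1 - q.1) u v = ((1 - p.1) * M) u v) ∧
    ∀ u ∈ C, ∀ v ∈ C, q.2 u v = (Mᵀ * p.2 * M) u v

/-- `C` is a union of connected components of `B`. -/
def ClosedB (B : Set (α × α)) (C : Set α) : Prop :=
  ∀ u v, (u, v) ∈ B → (u ∈ C ↔ v ∈ C)

theorem uu_one_sub {D : Set (α × α)} {b : α → ℕ}
    (hb : ∀ u v, (u, v) ∈ D → b u < b v) {L : Matrix α α ℝ}
    (hL : ∀ v w, L v w ≠ 0 → (v, w) ∈ D) : UU b (1 - L) := by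
  constructor
  · intro i
    have : L i i = 0 := by
      by_contra h
      exact absurd (hb _ _ (hL _ _ h)) (lt_irrefl _)
    simp [this]
  · intro i j hij hne
    apply hb _ _ (hL _ _ _)
    simpa [Matrix.one_apply, hij] using hne

theorem tmt_apply (M Ω : Matrix α α ℝ) (u v : α) :
    (Mᵀ * Ω * M) u v = ∑ j, (∑ i, M i u * Ω i j) * M j v := by
  simp [Matrix.mul_apply]

theorem phi_eq_iff {D : Set (α × α)} {b : α → ℕ}
    (hb : ∀ u v, (u, v) ∈ D → b u < b v) {p q : Matrix α α ℝ × Matrix α α ℝ}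
    (hp : ∀ v w, p.1 v w ≠ 0 → (v, w) ∈ D) (hq : ∀ v w, q.1 v w ≠ 0 → (v, w) ∈ D)
    {M : Matrix α α ℝ} (hM : 1 - q.1 = (1 - p.1) * M) :
    phi p = phi q ↔ q.2 = Mᵀ * p.2 * M := by
  obtain ⟨_, a1, a2⟩ := (uu_one_sub hb hp).inv
  obtain ⟨_, b1, b2⟩ := (uu_one_sub hb hq).inv
  unfold phi
  set A := 1 - p.1
  set A' := 1 - q.1
  have hM2 : M = A⁻¹ * A' := by rw [hM, ← Matrix.mul_assoc, a2, Matrix.one_mul]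
  have t1 : A'ᵀ * (A'⁻¹)ᵀ = 1 := by rw [← Matrix.transpose_mul, b2, Matrix.transpose_one]
  have t2 : (A'⁻¹)ᵀ * A'ᵀ = 1 := by rw [← Matrix.transpose_mul, b1, Matrix.transpose_one]
  have e : Mᵀ * p.2 * M = A'ᵀ * ((A⁻¹)ᵀ * p.2 * A⁻¹) * A' := by
    rw [hM2, Matrix.transpose_mul]; simp only [Matrix.mul_assoc]
  rw [e]
  constructor
  · intro h
    rw [h]
    have : A'ᵀ * ((A'⁻¹)ᵀ * q.2 * A'⁻¹) * A' = (A'ᵀ * (A'⁻¹)ᵀ) * q.2 * (A'⁻¹ * A') := by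
      simp only [Matrix.mul_assoc]
    rw [this, t1, b2]; simp
  · intro h
    rw [h]
    have : (A'⁻¹)ᵀ * (A'ᵀ * ((A⁻¹)ᵀ * p.2 * A⁻¹) * A') * A'⁻¹
        = ((A'⁻¹)ᵀ * A'ᵀ) * ((A⁻¹)ᵀ * p.2 * A⁻¹) * (A' * A'⁻¹) := by
      simp only [Matrix.mul_assoc]
    rw [this, t2, b1]; simp

theorem RC_of_phi {D B : Set (α × α)} {b : α → ℕ}
    (hb : ∀ u v, (u, v) ∈ D → b u < b v) {p q : Matrix α α ℝ × Matrix α α ℝ}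
    (hp : p ∈ Theta D B) (hq : q ∈ Theta D B) (h : phi p = phi q) {C : Set α}
    (hC : ClosedB B C) : RC C p q := by
  obtain ⟨ua, a1, a2⟩ := (uu_one_sub hb hp.1).inv
  set M := (1 - p.1)⁻¹ * (1 - q.1) with hMdef
  have hM : 1 - q.1 = (1 - p.1) * M := by
    rw [hMdef, ← Matrix.mul_assoc, a1, Matrix.one_mul]
  have hUM : UU b M := ua.mul (uu_one_sub hb hq.1)
  have hΩ := (phi_eq_iff hb hp.1 hq.1 hM).1 h
  obtain ⟨ui, m1, m2⟩ := hUM.inv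
  -- sign flip
  set s : α → ℝ := fun u => if u ∈ C then 1 else -1 with hs
  have hss : ∀ u, s u * s u = 1 := by intro u; simp only [hs]; split_ifs <;> norm_num
  set S := Matrix.diagonal s with hS
  have hSS : S * S = 1 := by
    rw [hS, Matrix.diagonal_mul_diagonal]
    simp [hss]
  have hSt : Sᵀ = S := Matrix.diagonal_transpose s
  have hcomm : ∀ r ∈ Theta D B, S * r.2 * S = r.2 := by
    intro r hr
    ext u v
    rw [hS, Matrix.mul_diagonal, Matrix.diagonal_mul]
    by_cases e : r.2 u v = 0
    · simp [e]
    · by_cases euv : u = v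
      · subst euv; linear_combination r.2 u u * hss u
      · have := hC u v (hr.2.2 u v euv e)
        have hsuv : s u = s v := by simp only [hs, this]
        rw [hsuv]; linear_combination r.2 u v * hss v
  set K := S * M * S * M⁻¹ with hK
  have hUS : UU b (S * M * S) := by
    constructor
    · intro i
      rw [hS, Matrix.mul_diagonal, Matrix.diagonal_mul, hUM.1, mul_one, hss]
    · intro i j hij hne
      rw [hS, Matrix.mul_diagonal, Matrix.diagonal_mul] at hne
      exact hUM.2 i j hij (right_ne_zero_of_mul (left_ne_zero_of_mul hne))
  have hKU : UU b K := hUS.mul ui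
  have hKi : Kᵀ * p.2 * K = p.2 := by
    have e1 : Kᵀ * p.2 * K = (M⁻¹)ᵀ * (S * (Mᵀ * (S * p.2 * S) * M) * S) * M⁻¹ := by
      rw [hK]; simp only [Matrix.transpose_mul, hSt, Matrix.mul_assoc]
    rw [e1, hcomm p hp, ← hΩ, hcomm q hq, hΩ]
    have : (M⁻¹)ᵀ * (Mᵀ * p.2 * M) * M⁻¹ = ((M⁻¹)ᵀ * Mᵀ) * p.2 * (M * M⁻¹) := by
      simp only [Matrix.mul_assoc]
    rw [this, ← Matrix.transpose_mul, m1]; simp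
  have hK1 := unip_isom hKU hp.2.1 hKi
  have hSMS : S * M * S = M := by
    have : S * M * S * M⁻¹ * M = M := by rw [← hK, hK1, Matrix.one_mul]
    rwa [Matrix.mul_assoc, m2, Matrix.mul_one] at this
  have hoff : ∀ u v, u ∉ C → v ∈ C → M u v = 0 := by
    intro u v hu hv
    have := congrFun (congrFun hSMS u) v
    rw [hS, Matrix.mul_diagonal, Matrix.diagonal_mul] at this
    simp only [hs, hu, hv, if_true, if_false] at this
    linarith
  obtain ⟨M', hM'⟩ : ∃ M' : Matrix α α ℝ, ∀ u v, M' u v =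
      if u ∈ C ∧ v ∈ C then M u v else (1 : Matrix α α ℝ) u v :=
    ⟨Matrix.of fun u v => if u ∈ C ∧ v ∈ C then M u v else (1 : Matrix α α ℝ) u v,
      fun _ _ => rfl⟩
  have hcol : ∀ v ∈ C, ∀ u, M' u v = M u v := by
    intro v hv u
    rw [hM']
    by_cases hu : u ∈ C
    · simp [hu, hv]
    · have : u ≠ v := fun e => hu (e ▸ hv)
      simp [hu, hoff u v hu hv, this]
  refine ⟨M', ?_, ?_, ?_⟩
  · intro u v huv; rw [hM', if_neg huv]
  · intro v hv u
    rw [hM, Matrix.mul_apply, Matrix.mul_apply]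
    exact Finset.sum_congr rfl fun k _ => by rw [hcol v hv k]
  · intro u hu v hv
    rw [hΩ, tmt_apply, tmt_apply]
    refine Finset.sum_congr rfl fun k _ => ?_
    rw [hcol v hv k]
    congr 1
    exact Finset.sum_congr rfl fun i _ => by rw [hcol u hu i]

theorem phi_of_RC {D B : Set (α × α)} {b : α → ℕ}
    (hb : ∀ u v, (u, v) ∈ D → b u < b v) {p q : Matrix α α ℝ × Matrix α α ℝ}
    (hp : p ∈ Theta D B) (hq : q ∈ Theta D B) {C : Set α}
    (hC : ClosedB B C) (hg : glue C p q = q) (h : RC C p q) : phi p = phi q := by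
  obtain ⟨M, h1, h2, h3⟩ := h
  have hzero : ∀ r ∈ Theta D B, ∀ u v, ¬ (u ∈ C ↔ v ∈ C) → r.2 u v = 0 := by
    intro r hr u v huv
    by_contra hne
    have : u ≠ v := by rintro rfl; exact huv Iff.rfl
    exact huv (hC u v (hr.2.2 u v this hne))
  have g1 : ∀ u v, v ∉ C → q.1 u v = p.1 u v := by
    intro u v hv
    rw [← hg, glue_fst, if_neg hv]
  have g2 : ∀ u v, ¬ (u ∈ C ∧ v ∈ C) → q.2 u v = p.2 u v := by
    intro u v hv
    rw [← hg, glue_snd, if_neg hv]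
  have hM : 1 - q.1 = (1 - p.1) * M := by
    ext u v
    by_cases hv : v ∈ C
    · exact h2 v hv u
    · rw [Matrix.mul_apply]
      simp only [h1 _ v (fun h => hv h.2)]
      rw [← Matrix.mul_apply, Matrix.mul_one]
      simp [g1 u v hv]
  refine (phi_eq_iff hb hp.1 hq.1 hM).2 ?_
  ext u v
  by_cases huv : u ∈ C ∧ v ∈ C
  · exact h3 u huv.1 v huv.2
  rw [g2 u v huv, tmt_apply]
  by_cases hu : u ∈ C
  · have hv : v ∉ C := fun h => huv ⟨hu, h⟩
    rw [hzero p hp u v (by tauto)]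
    symm
    apply Finset.sum_eq_zero
    intro j _
    rw [h1 j v (fun h => hv h.2)]
    by_cases hjv : j = v
    · subst hjv
      have : ∑ i, M i u * p.2 i j = 0 := by
        apply Finset.sum_eq_zero
        intro i _
        by_cases hi : i ∈ C
        · rw [hzero p hp i j (by tauto), mul_zero]
        · rw [h1 i u (fun h => hi h.1), Matrix.one_apply_ne (by rintro rfl; exact hi hu), zero_mul]
      rw [this, zero_mul]
    · rw [Matrix.one_apply_ne hjv, mul_zero]
  · have hcol : ∀ j, ∑ i, M i u * p.2 i j = p.2 u j := by
      intro j
      rw [Finset.sum_eq_single u]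
      · rw [h1 u u (fun h => hu h.1)]; simp
      · intro i _ hi
        rw [h1 i u (fun h => hu h.2), Matrix.one_apply_ne hi, zero_mul]
      · simp
    simp only [hcol]
    by_cases hv : v ∈ C
    · rw [hzero p hp u v (by tauto)]
      symm
      apply Finset.sum_eq_zero
      intro j _
      by_cases hj : j ∈ C
      · rw [hzero p hp u j (by tauto), zero_mul]
      · rw [h1 j v (fun h => hj h.1), Matrix.one_apply_ne (by rintro rfl; exact hj hv), mul_zero]
    · simp only [h1 _ v (fun h => hv h.2)]
      rw [← Matrix.mul_apply, Matrix.mul_one]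

/-- Agreement of the `C`-parts. -/
def Agree (C : Set α) (p q : Matrix α α ℝ × Matrix α α ℝ) : Prop :=
  (∀ u, ∀ v ∈ C, p.1 u v = q.1 u v) ∧ ∀ u ∈ C, ∀ v ∈ C, p.2 u v = q.2 u v

theorem RC_congr {C : Set α} {p p' q q' : Matrix α α ℝ × Matrix α α ℝ}
    (hp : Agree C p p') (hq : Agree C q q') (h : RC C p q) : RC C p' q' := by
  obtain ⟨M, h1, h2, h3⟩ := h
  have hM0 : ∀ u v, u ∉ C → v ∈ C → M u v = 0 := by
    intro u v hu hv
    rw [h1 u v (fun h => hu h.1), Matrix.one_apply_ne (by rintro rfl; exact hu hv)]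
  refine ⟨M, h1, ?_, ?_⟩
  · intro v hv u
    have := h2 v hv u
    rw [Matrix.sub_apply, hq.1 u v hv] at this
    rw [Matrix.sub_apply, this, Matrix.mul_apply, Matrix.mul_apply]
    refine Finset.sum_congr rfl fun k _ => ?_
    by_cases hk : k ∈ C
    · rw [Matrix.sub_apply, Matrix.sub_apply, hp.1 u k hk]
    · rw [hM0 k v hk hv]; simp
  · intro u hu v hv
    rw [← hq.2 u hu v hv, h3 u hu v hv, tmt_apply, tmt_apply]
    refine Finset.sum_congr rfl fun k _ => ?_
    by_cases hk : k ∈ C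
    · congr 1
      refine Finset.sum_congr rfl fun i _ => ?_
      by_cases hi : i ∈ C
      · rw [hp.2 i hi k hk]
      · rw [hM0 i u hi hu]; simp
    · rw [hM0 k v hk hv]; simp

end gen

section gen2
set_option linter.unusedSectionVars false
variable {α : Type} [Fintype α] [DecidableEq α]

theorem Theta_mono {D D' B B' : Set (α × α)} (hD : D ⊆ D') (hB : B ⊆ B') :
    Theta D B ⊆ Theta D' B' := fun _ hp =>
  ⟨fun v w h => hD (hp.1 v w h), hp.2.1, fun v w hn h => hB (hp.2.2 v w hn h)⟩

theorem quad_expand (A : Matrix α α ℝ) (x : α → ℝ) :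
    star x ⬝ᵥ (A *ᵥ x) = ∑ i, ∑ j, x i * (A i j * x j) := by
  simp [dotProduct, Matrix.mulVec, Finset.mul_sum]

theorem posDef_glue {C : Set α} {A A' G : Matrix α α ℝ} (hA : A.PosDef) (hA' : A'.PosDef)
    (h0 : ∀ u v, ¬ (u ∈ C ↔ v ∈ C) → A u v = 0)
    (hG : ∀ u v, G u v = if u ∈ C ∧ v ∈ C then A' u v else A u v) : G.PosDef := by
  apply Matrix.PosDef.of_dotProduct_mulVec_pos
  · ext u v
    have h1 : A v u = A u v := by simpa using hA.1.apply u v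
    have h2 : A' v u = A' u v := by simpa using hA'.1.apply u v
    rw [Matrix.conjTranspose_apply, hG, hG, h1, h2]
    simp only [star_trivial, and_comm]
  · intro x hx
    set y : α → ℝ := fun u => if u ∈ C then x u else 0 with hy
    set z : α → ℝ := fun u => if u ∈ C then 0 else x u with hz
    have key : star x ⬝ᵥ (G *ᵥ x) = star y ⬝ᵥ (A' *ᵥ y) + star z ⬝ᵥ (A *ᵥ z) := by
      rw [quad_expand, quad_expand, quad_expand, ← Finset.sum_add_distrib]
      refine Finset.sum_congr rfl fun i _ => ?_
      rw [← Finset.sum_add_distrib]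
      refine Finset.sum_congr rfl fun j _ => ?_
      rw [hG]
      by_cases hi : i ∈ C <;> by_cases hj : j ∈ C
      · simp [hy, hz, hi, hj]
      · simp [hy, hz, hi, hj, h0 i j (by tauto)]
      · simp [hy, hz, hi, hj, h0 i j (by tauto)]
      · simp [hy, hz, hi, hj]
    rw [key]
    have n1 := hA'.posSemidef.dotProduct_mulVec_nonneg y
    have n2 := hA.posSemidef.dotProduct_mulVec_nonneg z
    by_cases hy0 : y = 0
    · have hz0 : z ≠ 0 := by
        intro hz0
        apply hx
        ext u
        have a1 := congrFun hy0 u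
        have a2 := congrFun hz0 u
        by_cases hu : u ∈ C
        · simpa [hy, hu] using a1
        · simpa [hz, hu] using a2
      have := hA.dotProduct_mulVec_pos hz0
      linarith
    · have := hA'.dotProduct_mulVec_pos hy0
      linarith

theorem glue_mem {D1 B1 D2 B2 : Set (α × α)} {C : Set α}
    {p q : Matrix α α ℝ × Matrix α α ℝ} (hp : p ∈ Theta D1 B1) (hq : q ∈ Theta D2 B2)
    (hC : ClosedB B1 C) (hD : ∀ u v, v ∈ C → (u, v) ∈ D2 → (u, v) ∈ D1)
    (hB : ∀ u v, u ∈ C → v ∈ C → (u, v) ∈ B2 → (u, v) ∈ B1) :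
    glue C p q ∈ Theta D1 B1 := by
  refine ⟨?_, ?_, ?_⟩
  · intro u v h
    rw [glue_fst] at h
    by_cases hv : v ∈ C
    · rw [if_pos hv] at h
      exact hD u v hv (hq.1 u v h)
    · rw [if_neg hv] at h
      exact hp.1 u v h
  · refine posDef_glue hp.2.1 hq.2.1 ?_ (glue_snd C p q)
    intro u v huv
    by_contra hne
    have : u ≠ v := by rintro rfl; exact huv Iff.rfl
    exact huv (hC u v (hp.2.2 u v this hne))
  · intro u v huv h
    rw [glue_snd] at h
    by_cases hc : u ∈ C ∧ v ∈ C
    · rw [if_pos hc] at h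
      exact hB u v hc.1 hc.2 (hq.2.2 u v huv h)
    · rw [if_neg hc] at h
      exact hp.2.2 u v huv h

/-- The part of the fiber of `p` of points differing from `p` only at `C`. -/
def FC (D B : Set (α × α)) (C : Set α) (p : Matrix α α ℝ × Matrix α α ℝ) :
    Set (Matrix α α ℝ × Matrix α α ℝ) :=
  {q | q ∈ Theta D B ∧ glue C p q = q ∧ RC C p q}

theorem agree_glue (C : Set α) (p q : Matrix α α ℝ × Matrix α α ℝ) :
    Agree C q (glue C p q) :=
  ⟨fun u v hv => by rw [glue_fst, if_pos hv],
    fun u hu v hv => by rw [glue_snd, if_pos ⟨hu, hv⟩]⟩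

theorem Agree.symm {C : Set α} {p q : Matrix α α ℝ × Matrix α α ℝ} (h : Agree C p q) :
    Agree C q p :=
  ⟨fun u v hv => (h.1 u v hv).symm, fun u hu v hv => (h.2 u hu v hv).symm⟩

theorem Agree.trans {C : Set α} {p q r : Matrix α α ℝ × Matrix α α ℝ} (h : Agree C p q)
    (h' : Agree C q r) : Agree C p r :=
  ⟨fun u v hv => (h.1 u v hv).trans (h'.1 u v hv),
    fun u hu v hv => (h.2 u hu v hv).trans (h'.2 u hu v hv)⟩

theorem glue_congr {C : Set α} (p : Matrix α α ℝ × Matrix α α ℝ)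
    {q q' : Matrix α α ℝ × Matrix α α ℝ} (h : Agree C q q') : glue C p q = glue C p q' := by
  refine Prod.ext ?_ ?_
  · ext u v
    rw [glue_fst, glue_fst]
    split_ifs with hv
    · exact h.1 u v hv
    · rfl
  · ext u v
    rw [glue_snd, glue_snd]
    split_ifs with hv
    · exact h.2 u hv.1 v hv.2
    · rfl

theorem FC_transfer {D1 B1 D2 B2 : Set (α × α)} {C : Set α}
    {p1 p2 : Matrix α α ℝ × Matrix α α ℝ} (hp2 : p2 ∈ Theta D2 B2)
    (hC : ClosedB B2 C) (hD : ∀ u v, v ∈ C → (u, v) ∈ D1 → (u, v) ∈ D2)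
    (hB : ∀ u v, u ∈ C → v ∈ C → (u, v) ∈ B1 → (u, v) ∈ B2)
    (hag : Agree C p1 p2) (hfin : (FC D2 B2 C p2).Finite) : (FC D1 B1 C p1).Finite := by
  refine Set.Finite.of_injOn (f := fun q => glue C p2 q) (t := FC D2 B2 C p2) ?_ ?_ hfin
  · rintro q ⟨hq, hg, hR⟩
    refine ⟨glue_mem hp2 hq hC hD hB, ?_, ?_⟩
    · exact (glue_congr p2 (agree_glue C p2 q)).symm
    · exact RC_congr hag (agree_glue C p2 q) hR
  · rintro q ⟨hq, hg, hR⟩ q' ⟨hq', hg', hR'⟩ h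
    have h : glue C p2 q = glue C p2 q' := h
    have : Agree C q q' := by
      refine (agree_glue C p2 q).trans ?_
      rw [h]
      exact (agree_glue C p2 q').symm
    rw [← hg, ← hg']
    exact glue_congr p1 this

end gen2

section ext
set_option linter.unusedSectionVars false
variable {α : Type} [Fintype α] [DecidableEq α] (V : Finset α)

/-- Extension of a matrix on `V` by `T` on the complement. -/
noncomputable def EE (T : Matrix {x // ¬ x ∈ V} {x // ¬ x ∈ V} ℝ) (A : Matrix V V ℝ) :
    Matrix α α ℝ :=
  (Matrix.fromBlocks A 0 0 T).submatrix (Equiv.sumCompl (· ∈ V)).symm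
    (Equiv.sumCompl (· ∈ V)).symm

theorem EE_mem (T : Matrix {x // ¬ x ∈ V} {x // ¬ x ∈ V} ℝ) (A : Matrix V V ℝ) (u v : V) :
    EE V T A u v = A u v := by
  simp [EE, Equiv.sumCompl_symm_apply_of_pos]

theorem EE_not (T : Matrix {x // ¬ x ∈ V} {x // ¬ x ∈ V} ℝ) (A : Matrix V V ℝ) (u v : α)
    (h : ¬ (u ∈ V ∧ v ∈ V)) : EE V T A u v = EE V T 0 u v := by
  by_cases hu : u ∈ V
  · have hv : ¬ v ∈ V := fun hv => h ⟨hu, hv⟩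
    simp [EE, Equiv.sumCompl_symm_apply_of_pos hu, Equiv.sumCompl_symm_apply_of_neg hv]
  · by_cases hv : v ∈ V
    · simp [EE, Equiv.sumCompl_symm_apply_of_neg hu, Equiv.sumCompl_symm_apply_of_pos hv]
    · simp [EE, Equiv.sumCompl_symm_apply_of_neg hu, Equiv.sumCompl_symm_apply_of_neg hv]

theorem EE_one : EE V 1 1 = 1 := by
  simp [EE]

theorem EE_zero : EE V 0 0 = 0 := by
  simp [EE]

theorem EE_not_one (A : Matrix V V ℝ) (u v : α)
    (h : ¬ (u ∈ V ∧ v ∈ V)) : EE V 1 A u v = (1 : Matrix α α ℝ) u v := by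
  rw [EE_not V 1 A u v h, ← EE_not V 1 1 u v h, EE_one]

theorem EE_not_zero (A : Matrix V V ℝ) (u v : α)
    (h : ¬ (u ∈ V ∧ v ∈ V)) : EE V 0 A u v = 0 := by
  rw [EE_not V 0 A u v h, EE_zero]; rfl

theorem EE_mul (A A' : Matrix V V ℝ) : EE V 1 A * EE V 1 A' = EE V 1 (A * A') := by
  unfold EE
  rw [Matrix.submatrix_mul_equiv, Matrix.fromBlocks_multiply]
  simp

theorem EE_transpose (A : Matrix V V ℝ) : (EE V 1 A)ᵀ = EE V 1 Aᵀ := by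
  unfold EE
  rw [Matrix.transpose_submatrix, Matrix.fromBlocks_transpose]
  simp

theorem EE_inj {A A' : Matrix V V ℝ} (h : EE V 1 A = EE V 1 A') : A = A' := by
  ext u v
  rw [← EE_mem V 1 A, h, EE_mem]

theorem EE_one_sub (L : Matrix V V ℝ) : 1 - EE V 0 L = EE V 1 (1 - L) := by
  ext u v
  by_cases h : u ∈ V ∧ v ∈ V
  · have h1 := EE_mem V 0 L ⟨u, h.1⟩ ⟨v, h.2⟩
    have h2 := EE_mem V 1 (1 - L) ⟨u, h.1⟩ ⟨v, h.2⟩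
    simp only at h1 h2
    rw [Matrix.sub_apply, h1, h2, Matrix.sub_apply, Matrix.one_apply, Matrix.one_apply]
    simp [Subtype.ext_iff]
  · rw [Matrix.sub_apply, EE_not_zero V _ u v h, EE_not_one V _ u v h, sub_zero]

theorem EE_posDef {A : Matrix V V ℝ} (hA : A.PosDef) : (EE V 1 A).PosDef := by
  have : (Matrix.fromBlocks A 0 0 (1 : Matrix {x // ¬ x ∈ V} {x // ¬ x ∈ V} ℝ)).PosDef := by
    apply Matrix.PosDef.of_dotProduct_mulVec_pos
    · apply Matrix.IsHermitian.fromBlocks hA.1 (by simp) Matrix.isHermitian_one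
    · intro x hx
      have key : star x ⬝ᵥ (Matrix.fromBlocks A 0 0
          (1 : Matrix {x // ¬ x ∈ V} {x // ¬ x ∈ V} ℝ) *ᵥ x)
          = star (x ∘ Sum.inl) ⬝ᵥ (A *ᵥ (x ∘ Sum.inl))
            + star (x ∘ Sum.inr) ⬝ᵥ ((1 : Matrix {x // ¬ x ∈ V} {x // ¬ x ∈ V} ℝ) *ᵥ
              (x ∘ Sum.inr)) := by
        rw [Matrix.fromBlocks_mulVec]
        simp [dotProduct, Fintype.sum_sum_type]
      rw [key]
      have h1 : (1 : Matrix {x // ¬ x ∈ V} {x // ¬ x ∈ V} ℝ).PosDef := Matrix.PosDef.one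
      have n1 := hA.posSemidef.dotProduct_mulVec_nonneg (x ∘ Sum.inl)
      have n2 := h1.posSemidef.dotProduct_mulVec_nonneg (x ∘ Sum.inr)
      by_cases e : x ∘ Sum.inl = 0
      · have e2 : x ∘ Sum.inr ≠ 0 := by
          intro e2
          apply hx
          ext i
          rcases i with i | i
          · exact congrFun e i
          · exact congrFun e2 i
        have := h1.dotProduct_mulVec_pos e2
        linarith
      · have := hA.dotProduct_mulVec_pos e
        linarith
  exact this.submatrix (Equiv.injective _)

/-- Extension of parameters from `V` to the whole vertex set. -/
noncomputable def extV (q : Matrix V V ℝ × Matrix V V ℝ) : Matrix α α ℝ × Matrix α α ℝ :=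
  (EE V 0 q.1, EE V 1 q.2)

/-- Restriction of parameters to `V`. -/
def restr (p : Matrix α α ℝ × Matrix α α ℝ) : Matrix V V ℝ × Matrix V V ℝ :=
  (p.1.submatrix Subtype.val Subtype.val, p.2.submatrix Subtype.val Subtype.val)

/-- Edges between vertices in `V`. -/
def pull (X : Set (α × α)) : Set (V × V) := {e | ((e.1 : α), (e.2 : α)) ∈ X}

theorem restr_ext (q : Matrix V V ℝ × Matrix V V ℝ) : restr V (extV V q) = q := by
  refine Prod.ext ?_ ?_
  · ext u v; exact EE_mem V 0 q.1 u v
  · ext u v; exact EE_mem V 1 q.2 u v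

variable {V}

theorem ext_mem {D B : Set (α × α)} {q : Matrix V V ℝ × Matrix V V ℝ}
    (hq : q ∈ Theta (pull V D) (pull V B)) : extV V q ∈ Theta D B := by
  refine ⟨?_, EE_posDef V hq.2.1, ?_⟩
  · intro u v h
    by_cases huv : u ∈ V ∧ v ∈ V
    · have h1 := EE_mem V 0 q.1 ⟨u, huv.1⟩ ⟨v, huv.2⟩
      have h2 : EE V 0 q.1 u v ≠ 0 := h
      simp only at h1
      rw [h1] at h2
      exact hq.1 _ _ h2
    · exact absurd (EE_not_zero V q.1 u v huv) h
  · intro u v hne h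
    by_cases huv : u ∈ V ∧ v ∈ V
    · have h1 := EE_mem V 1 q.2 ⟨u, huv.1⟩ ⟨v, huv.2⟩
      have h2 : EE V 1 q.2 u v ≠ 0 := h
      simp only at h1
      rw [h1] at h2
      exact hq.2.2 _ _ (by simpa [Subtype.ext_iff] using hne) h2
    · exact absurd ((EE_not_one V q.2 u v huv).trans (Matrix.one_apply_ne hne)) h

theorem restr_mem {D B : Set (α × α)} {p : Matrix α α ℝ × Matrix α α ℝ}
    (hp : p ∈ Theta D B) : restr V p ∈ Theta (pull V D) (pull V B) := by
  refine ⟨fun u v h => hp.1 _ _ h, hp.2.1.submatrix Subtype.val_injective, ?_⟩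
  intro u v hne h
  exact hp.2.2 _ _ (fun e => hne (Subtype.ext e)) h

theorem phi_ext {D B : Set (α × α)} {b : α → ℕ}
    (hb : ∀ u v, (u, v) ∈ D → b u < b v) {q : Matrix V V ℝ × Matrix V V ℝ}
    (hq : q ∈ Theta (pull V D) (pull V B)) : phi (extV V q) = EE V 1 (phi q) := by
  have hb' : ∀ u v : V, (u, v) ∈ pull V D → b u < b v := fun u v h => hb _ _ h
  obtain ⟨_, a1, a2⟩ := (uu_one_sub (b := fun v : V => b v) hb' hq.1).inv
  have hinv : (1 - EE V 0 q.1)⁻¹ = EE V 1 (1 - q.1)⁻¹ := by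
    apply Matrix.inv_eq_right_inv
    rw [EE_one_sub, EE_mul, a1, EE_one]
  show ((1 - EE V 0 q.1)⁻¹)ᵀ * EE V 1 q.2 * (1 - EE V 0 q.1)⁻¹ = _
  rw [hinv, EE_transpose, EE_mul, EE_mul]
  rfl

theorem fiber_ext {D B : Set (α × α)} {b : α → ℕ} {C : Set α}
    (hb : ∀ u v, (u, v) ∈ D → b u < b v)
    (hD : ∀ u v, (u, v) ∈ D → u ∈ V ∧ v ∈ C)
    (hB : ∀ u v, (u, v) ∈ B → u ∈ C ∧ v ∈ C) (hCV : ∀ v ∈ C, v ∈ V)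
    {q : Matrix V V ℝ × Matrix V V ℝ} (hq : q ∈ Theta (pull V D) (pull V B)) :
    (fiber (pull V D) (pull V B) q).Finite ↔ (FC D B C (extV V q)).Finite := by
  have hCl : ClosedB B C := fun u v h => by have := hB u v h; tauto
  have heq : FC D B C (extV V q) = extV V '' (fiber (pull V D) (pull V B) q) := by
    apply Set.eq_of_subset_of_subset
    · rintro r ⟨hr, hg, hR⟩
      have hphi := phi_of_RC hb (ext_mem hq) hr hCl hg hR
      have hre : extV V (restr V r) = r := by
        refine Prod.ext ?_ ?_
        · ext u v
          by_cases huv : u ∈ V ∧ v ∈ V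
          · exact EE_mem V 0 (restr V r).1 ⟨u, huv.1⟩ ⟨v, huv.2⟩
          · refine (EE_not_zero V (restr V r).1 u v huv).trans ?_
            by_contra hne
            have := hD u v (hr.1 u v (Ne.symm hne))
            exact huv ⟨this.1, hCV _ this.2⟩
        · ext u v
          by_cases huv : u ∈ V ∧ v ∈ V
          · exact EE_mem V 1 (restr V r).2 ⟨u, huv.1⟩ ⟨v, huv.2⟩
          · refine (EE_not_one V (restr V r).2 u v huv).trans ?_
            rw [← hg, glue_snd, if_neg (fun h => huv ⟨hCV _ h.1, hCV _ h.2⟩)]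
            exact (EE_not_one V q.2 u v huv).symm
      refine ⟨restr V r, ⟨restr_mem hr, ?_⟩, hre⟩
      apply EE_inj V
      rw [← phi_ext hb (restr_mem hr), ← phi_ext hb hq, hre, hphi]
    · rintro _ ⟨r, ⟨hr, hphi⟩, rfl⟩
      have hphi' : phi (extV V q) = phi (extV V r) := by
        rw [phi_ext hb hq, phi_ext hb hr, hphi]
      refine ⟨ext_mem hr, ?_, RC_of_phi hb (ext_mem hq) (ext_mem hr) hphi' hCl⟩
      have mq := ext_mem hq
      have mr := ext_mem hr
      refine Prod.ext ?_ ?_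
      · ext u v
        rw [glue_fst]
        split_ifs with hv
        · rfl
        · have z : ∀ s ∈ Theta D B, s.1 u v = 0 := by
            intro s hs
            by_contra hne
            exact hv (hD u v (hs.1 u v hne)).2
          rw [z _ mq, z _ mr]
      · ext u v
        rw [glue_snd]
        split_ifs with huv
        · rfl
        · by_cases e : u = v
          · subst e
            have hu : u ∉ C := fun h => huv ⟨h, h⟩
            have hcl : ClosedB B {u} := by
              intro x y hxy
              have := hB x y hxy
              constructor
              · rintro rfl; exact absurd this.1 hu
              · rintro rfl; exact absurd this.2 hu
            obtain ⟨M, h1, h2, h3⟩ := RC_of_phi hb mq mr hphi' hcl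
            have hdz : ∀ s ∈ Theta D B, s.1 u u = 0 := by
              intro s hs
              by_contra hne
              exact lt_irrefl _ (hb u u (hs.1 u u hne))
            have hcolz : ∀ i, i ≠ u → M i u = 0 := by
              intro i hi
              rw [h1 i u (fun h => hi h.1), Matrix.one_apply_ne hi]
            have hM : M u u = 1 := by
              have := h2 u rfl u
              rw [Matrix.mul_apply, Finset.sum_eq_single u] at this
              · simp only [Matrix.sub_apply, hdz _ mq, hdz _ mr, Matrix.one_apply_eq] at this
                linarith
              · intro i _ hi; rw [hcolz i hi, mul_zero]
              · simp
            have := h3 u rfl u rfl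
            rw [tmt_apply, Finset.sum_eq_single u, Finset.sum_eq_single u, hM, one_mul,
              mul_one] at this
            · exact this.symm
            · intro i _ hi; rw [hcolz i hi, zero_mul]
            · simp
            · intro i _ hi; rw [hcolz i hi, mul_zero]
            · simp
          · have z : ∀ s ∈ Theta D B, s.2 u v = 0 := by
              intro s hs
              by_contra hne
              exact huv (hB u v (hs.2.2 u v e hne))
            rw [z _ mq, z _ mr]
  rw [heq, Set.finite_image_iff]
  intro r _ r' _ h
  rw [← restr_ext V r, h, restr_ext]

end ext

theorem poly_pull {α β : Type} [Fintype α] [Fintype β]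
    (T : Matrix β β ℝ × Matrix β β ℝ → Matrix α α ℝ × Matrix α α ℝ)
    (h1 : ∀ u v, ∃ g, ∀ p, polyEval g p = (T p).1 u v)
    (h2 : ∀ u v, ∃ g, ∀ p, polyEval g p = (T p).2 u v)
    (f : MvPolynomial ((α × α) ⊕ (α × α)) ℝ) :
    ∃ g, ∀ p, polyEval g p = polyEval f (T p) := by
  choose g1 hg1 using h1
  choose g2 hg2 using h2
  refine ⟨MvPolynomial.bind₁ (Sum.elim (fun e => g1 e.1 e.2) (fun e => g2 e.1 e.2)) f, ?_⟩
  intro p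
  unfold polyEval
  rw [MvPolynomial.eval, MvPolynomial.eval₂Hom_bind₁]
  congr 1
  congr 1
  funext e
  rcases e with e | e
  · exact hg1 e.1 e.2 p
  · exact hg2 e.1 e.2 p

theorem poly_const {β : Type} [Fintype β] (x : ℝ) :
    ∃ g : MvPolynomial ((β × β) ⊕ (β × β)) ℝ, ∀ p, polyEval g p = x :=
  ⟨MvPolynomial.C x, fun p => by simp [polyEval]⟩

theorem poly_fst {β : Type} [Fintype β] (u v : β) :
    ∃ g : MvPolynomial ((β × β) ⊕ (β × β)) ℝ, ∀ p, polyEval g p = p.1 u v :=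
  ⟨MvPolynomial.X (Sum.inl (u, v)), fun p => by simp [polyEval]⟩

theorem poly_snd {β : Type} [Fintype β] (u v : β) :
    ∃ g : MvPolynomial ((β × β) ⊕ (β × β)) ℝ, ∀ p, polyEval g p = p.2 u v :=
  ⟨MvPolynomial.X (Sum.inr (u, v)), fun p => by simp [polyEval]⟩

theorem poly_glue_ext {α : Type} [Fintype α] [DecidableEq α] (V : Finset α) (C : Set α)
    (p : Matrix α α ℝ × Matrix α α ℝ) (f : MvPolynomial ((α × α) ⊕ (α × α)) ℝ) :
    ∃ g : MvPolynomial ((V × V) ⊕ (V × V)) ℝ,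
      ∀ q, polyEval g q = polyEval f (glue C p (extV V q)) := by
  apply poly_pull
  · intro u v
    simp only [glue_fst]
    split_ifs with hv
    · by_cases huv : u ∈ V ∧ v ∈ V
      · obtain ⟨g, hg⟩ := poly_fst (⟨u, huv.1⟩ : V) (⟨v, huv.2⟩ : V)
        refine ⟨g, fun q => ?_⟩
        rw [hg]
        exact (EE_mem V 0 q.1 ⟨u, huv.1⟩ ⟨v, huv.2⟩).symm
      · obtain ⟨g, hg⟩ := poly_const (β := V) 0
        refine ⟨g, fun q => ?_⟩
        rw [hg]
        exact (EE_not_zero V q.1 u v huv).symm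
    · exact poly_const _
  · intro u v
    simp only [glue_snd]
    split_ifs with hv
    · by_cases huv : u ∈ V ∧ v ∈ V
      · obtain ⟨g, hg⟩ := poly_snd (⟨u, huv.1⟩ : V) (⟨v, huv.2⟩ : V)
        refine ⟨g, fun q => ?_⟩
        rw [hg]
        exact (EE_mem V 1 q.2 ⟨u, huv.1⟩ ⟨v, huv.2⟩).symm
      · obtain ⟨g, hg⟩ := poly_const (β := V) ((1 : Matrix α α ℝ) u v)
        refine ⟨g, fun q => ?_⟩
        rw [hg]
        exact (EE_not_one V q.2 u v huv).symm
    · exact poly_const _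

/-- The part of `p` at `C`, with diagonal error variances elsewhere. -/
noncomputable def loc {α : Type} [Fintype α] [DecidableEq α] (C : Set α)
    (p : Matrix α α ℝ × Matrix α α ℝ) : Matrix α α ℝ × Matrix α α ℝ :=
  glue C (0, Matrix.diagonal fun v => p.2 v v) p

theorem poly_restr_loc {α : Type} [Fintype α] [DecidableEq α] (V : Finset α) (C : Set α)
    (f : MvPolynomial ((V × V) ⊕ (V × V)) ℝ) :
    ∃ g : MvPolynomial ((α × α) ⊕ (α × α)) ℝ,
      ∀ p, polyEval g p = polyEval f (restr V (loc C p)) := by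
  apply poly_pull
  · intro u v
    have : ∀ p : Matrix α α ℝ × Matrix α α ℝ, (restr V (loc C p)).1 u v
        = if (v : α) ∈ C then p.1 u v else 0 := fun p => rfl
    simp only [this]
    split_ifs
    · exact poly_fst _ _
    · exact poly_const _
  · intro u v
    have : ∀ p : Matrix α α ℝ × Matrix α α ℝ, (restr V (loc C p)).2 u v
        = if (u : α) ∈ C ∧ (v : α) ∈ C then p.2 u v else
          Matrix.diagonal (fun v => p.2 v v) (u : α) (v : α) := fun p => rfl
    simp only [this]
    split_ifs
    · exact poly_snd _ _
    · by_cases e : (u : α) = v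
      · simp only [e, Matrix.diagonal_apply_eq]
        exact poly_snd _ _
      · simp only [Matrix.diagonal_apply_ne _ e]
        exact poly_const _

theorem loc_mem {α : Type} [Fintype α] [DecidableEq α] {D B D' B' : Set (α × α)} {C : Set α}
    {p : Matrix α α ℝ × Matrix α α ℝ} (hp : p ∈ Theta D B) (hC : ClosedB B' C)
    (hD : ∀ u v, v ∈ C → (u, v) ∈ D → (u, v) ∈ D')
    (hB : ∀ u v, u ∈ C → v ∈ C → (u, v) ∈ B → (u, v) ∈ B') :
    loc C p ∈ Theta D' B' := by
  refine glue_mem ⟨?_, ?_, ?_⟩ hp hC hD hB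
  · intro v w h; exact absurd rfl h
  · exact Matrix.PosDef.diagonal fun v => hp.2.1.diag_pos
  · intro v w hne h; exact absurd (Matrix.diagonal_apply_ne _ hne) h

theorem agree_ext_restr {α : Type} [Fintype α] [DecidableEq α] {V : Finset α} {C : Set α}
    (hCV : ∀ v ∈ C, v ∈ V) {p : Matrix α α ℝ × Matrix α α ℝ}
    (hpV : ∀ u v, v ∈ C → p.1 u v ≠ 0 → u ∈ V) : Agree C (extV V (restr V p)) p := by
  constructor
  · intro u v hv
    by_cases hu : u ∈ V
    · exact EE_mem V 0 (restr V p).1 ⟨u, hu⟩ ⟨v, hCV v hv⟩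
    · refine (EE_not_zero V _ u v (fun h => hu h.1)).trans ?_
      by_contra hne
      exact hu (hpV u v hv (Ne.symm hne))
  · intro u hu v hv
    exact EE_mem V 1 (restr V p).2 ⟨u, hCV u hu⟩ ⟨v, hCV v hv⟩

theorem loc_of_mem {α : Type} [Fintype α] [DecidableEq α] {D B : Set (α × α)} {C : Set α}
    (hD : ∀ u v, (u, v) ∈ D → v ∈ C) (hB : ∀ u v, (u, v) ∈ B → u ∈ C ∧ v ∈ C)
    {p : Matrix α α ℝ × Matrix α α ℝ} (hp : p ∈ Theta D B) : loc C p = p := by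
  refine Prod.ext ?_ ?_
  · ext u v
    rw [loc, glue_fst]
    split_ifs with hv
    · rfl
    · by_contra hne
      exact hv (hD u v (hp.1 u v (Ne.symm hne)))
  · ext u v
    rw [loc, glue_snd]
    split_ifs with hv
    · rfl
    · by_cases e : u = v
      · subst e; simp
      · refine (Matrix.diagonal_apply_ne _ e).trans ?_
        by_contra hne
        exact hv (hB u v (hp.2.2 u v e (Ne.symm hne)))

theorem exists_rank {n : ℕ} {D : Finset (Fin n × Fin n)} (h : Acyclic D) :
    ∃ b : Fin n → ℕ, ∀ u v, (u, v) ∈ D → b u < b v := by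
  refine ⟨fun v => (Finset.univ.filter fun u =>
    Relation.TransGen (fun a b => (a, b) ∈ D) u v).card, ?_⟩
  intro u v huv
  apply Finset.card_lt_card
  rw [Finset.ssubset_iff_of_subset]
  · refine ⟨u, ?_, ?_⟩
    · simpa using Relation.TransGen.single huv
    · simpa using h u
  · intro w hw
    simp only [Finset.mem_filter, Finset.mem_univ, true_and] at hw ⊢
    exact hw.tail huv

theorem mem_Cset {n : ℕ} {B : Finset (Fin n × Fin n)} {c w : Fin n} :
    w ∈ Cset B c ↔ bidirConn B c w := by simp [Cset]

theorem bidirConn_symm {n : ℕ} {B : Finset (Fin n × Fin n)}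
    (hB : ∀ v w, (v, w) ∈ B → (w, v) ∈ B) {c w : Fin n} (h : bidirConn B c w) :
    bidirConn B w c := by
  unfold bidirConn at h ⊢
  induction h with
  | refl => exact Relation.ReflTransGen.refl
  | tail _ hbc ih => exact Relation.ReflTransGen.head (hB _ _ hbc) ih

theorem Cset_closed {n : ℕ} {B : Finset (Fin n × Fin n)}
    (hB : ∀ v w, (v, w) ∈ B → (w, v) ∈ B) (c : Fin n) :
    ClosedB (↑B : Set (Fin n × Fin n)) (↑(Cset B c) : Set (Fin n)) := by
  intro u v huv
  rw [Finset.mem_coe, Finset.mem_coe, mem_Cset, mem_Cset]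
  exact ⟨fun h => Relation.ReflTransGen.tail h huv,
    fun h => Relation.ReflTransGen.tail h (hB _ _ huv)⟩

theorem Cset_eq_or_disj {n : ℕ} {B : Finset (Fin n × Fin n)}
    (hB : ∀ v w, (v, w) ∈ B → (w, v) ∈ B) (c d : Fin n) :
    Cset B c = Cset B d ∨ ∀ v ∈ Cset B c, v ∉ Cset B d := by
  by_cases h : ∃ v, v ∈ Cset B c ∧ v ∈ Cset B d
  · left
    obtain ⟨v, h1, h2⟩ := h
    rw [mem_Cset] at h1 h2
    ext w
    rw [mem_Cset, mem_Cset]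
    have cd : bidirConn B c d := Relation.ReflTransGen.trans h1 (bidirConn_symm hB h2)
    exact ⟨fun h => Relation.ReflTransGen.trans (bidirConn_symm hB cd) h,
      fun h => Relation.ReflTransGen.trans cd h⟩
  · right
    intro v h1 h2
    exact h ⟨v, h1, h2⟩

/-- Directed edges of the mixed component, on the full vertex set. -/
def Dc {n : ℕ} (D B : Finset (Fin n × Fin n)) (c : Fin n) : Set (Fin n × Fin n) :=
  {e | (e.1, e.2) ∈ D ∧ e.2 ∈ Cset B c}

/-- Bidirected edges of the mixed component, on the full vertex set. -/
def Bc {n : ℕ} (B : Finset (Fin n × Fin n)) (c : Fin n) : Set (Fin n × Fin n) :=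
  {e | (e.1, e.2) ∈ B ∧ e.1 ∈ Cset B c ∧ e.2 ∈ Cset B c}

theorem compD_eq {n : ℕ} (D B : Finset (Fin n × Fin n)) (c : Fin n) :
    compD D B c = pull (Vset D B c) (Dc D B c) := rfl

theorem compB_eq {n : ℕ} (D B : Finset (Fin n × Fin n)) (c : Fin n) :
    compB D B c = pull (Vset D B c) (Bc B c) := rfl

theorem Dc_prop {n : ℕ} (D B : Finset (Fin n × Fin n)) (c u v : Fin n)
    (h : (u, v) ∈ Dc D B c) : u ∈ Vset D B c ∧ v ∈ (↑(Cset B c) : Set (Fin n)) := by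
  refine ⟨?_, h.2⟩
  rw [Vset, Finset.mem_union]
  right
  simp only [Finset.mem_filter, Finset.mem_univ, true_and]
  exact ⟨v, h.2, h.1⟩

theorem Bc_prop {n : ℕ} (B : Finset (Fin n × Fin n)) (c u v : Fin n)
    (h : (u, v) ∈ Bc B c) :
    u ∈ (↑(Cset B c) : Set (Fin n)) ∧ v ∈ (↑(Cset B c) : Set (Fin n)) := h.2

theorem C_sub_V {n : ℕ} (D B : Finset (Fin n × Fin n)) (c : Fin n) :
    ∀ v ∈ (↑(Cset B c) : Set (Fin n)), v ∈ Vset D B c := by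
  intro v hv
  rw [Vset, Finset.mem_union]
  exact Or.inl hv

theorem fiber_finite_of_FC {n : ℕ} {D B : Finset (Fin n × Fin n)} (hG : IsMixedGraph D B)
    {b : Fin n → ℕ} (hb : ∀ u v, (u, v) ∈ (↑D : Set (Fin n × Fin n)) → b u < b v)
    {p : Matrix (Fin n) (Fin n) ℝ × Matrix (Fin n) (Fin n) ℝ}
    (hp : p ∈ Theta (↑D : Set (Fin n × Fin n)) ↑B)
    (h : ∀ c, (FC (↑D : Set (Fin n × Fin n)) ↑B ↑(Cset B c) p).Finite) :
    (fiber (↑D : Set (Fin n × Fin n)) ↑B p).Finite := by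
  refine Set.Finite.of_injOn
    (f := fun q => fun c : Fin n => glue (↑(Cset B c) : Set (Fin n)) p q) ?_ ?_
    (Set.Finite.pi' h)
  · rintro q ⟨hq, hphi⟩ c
    have hcl := Cset_closed hG.1 c
    refine ⟨glue_mem hp hq hcl (fun _ _ _ h => h) (fun _ _ _ _ h => h), ?_, ?_⟩
    · exact (glue_congr p (agree_glue _ p q)).symm
    · exact RC_congr (p := p) (q := q) ⟨fun _ _ _ => rfl, fun _ _ _ _ => rfl⟩ (agree_glue _ p q)
        (RC_of_phi hb hp hq hphi.symm hcl)
  · rintro q ⟨hq, hphi⟩ q' ⟨hq', hphi'⟩ heq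
    have heq' : ∀ c : Fin n, glue (↑(Cset B c) : Set (Fin n)) p q
        = glue (↑(Cset B c) : Set (Fin n)) p q' := fun c => congrFun heq c
    have hself : ∀ c : Fin n, c ∈ (↑(Cset B c) : Set (Fin n)) := fun c => by
      rw [Finset.mem_coe, mem_Cset]; exact Relation.ReflTransGen.refl
    have hag : ∀ c : Fin n, Agree (↑(Cset B c) : Set (Fin n)) q q' := by
      intro c
      refine (agree_glue _ p q).trans ?_
      rw [heq' c]
      exact (agree_glue _ p q').symm
    refine Prod.ext ?_ ?_
    · ext u v
      exact (hag v).1 u v (hself v)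
    · ext u v
      by_cases hv : v ∈ (↑(Cset B u) : Set (Fin n))
      · exact (hag u).2 u (hself u) v hv
      · have z : ∀ s ∈ Theta (↑D : Set (Fin n × Fin n)) ↑B, s.2 u v = 0 := by
          intro s hs
          by_contra hne
          have huv : u ≠ v := by rintro rfl; exact hv (hself u)
          exact hv ((Cset_closed hG.1 u u v (hs.2.2 u v huv hne)).1 (hself u))
        rw [z q hq, z q' hq']

theorem stmt10 (n : ℕ) (D B : Finset (Fin n × Fin n))
    (hG : IsMixedGraph D B) (hacyc : Acyclic D) :
    GenInfToOne (↑D : Set (Fin n × Fin n)) ↑B ↔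
      ∃ c : Fin n, GenInfToOne (compD D B c) (compB D B c) := by
  obtain ⟨b, hb⟩ := exists_rank hacyc
  have hb1 : ∀ u v, (u, v) ∈ (↑D : Set (Fin n × Fin n)) → b u < b v := hb
  have hb2 : ∀ c u v, (u, v) ∈ Dc D B c → b u < b v := fun c u v h => hb u v h.1
  have hclc : ∀ c, ClosedB (Bc B c) (↑(Cset B c) : Set (Fin n)) :=
    fun c u v h => ⟨fun _ => h.2.2, fun _ => h.2.1⟩
  have hDD : ∀ c, Dc D B c ⊆ (↑D : Set (Fin n × Fin n)) := fun c e h => h.1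
  have hBB : ∀ c, Bc B c ⊆ (↑B : Set (Fin n × Fin n)) := fun c e h => h.1
  constructor
  · rintro ⟨A, ⟨f, ⟨p0, hp0, hf0⟩, rfl⟩, hinf⟩
    by_contra hno
    push Not at hno
    have step : ∀ S : Finset (Fin n), ∃ p ∈ Theta (↑D : Set (Fin n × Fin n)) ↑B,
        polyEval f p ≠ 0 ∧ ∀ c ∈ S, (FC (↑D : Set (Fin n × Fin n)) ↑B ↑(Cset B c) p).Finite := by
      intro S
      induction S using Finset.induction_on with
      | empty => exact ⟨p0, hp0, hf0, by simp⟩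
      | insert c S hcS ih =>
        obtain ⟨p, hp, hfp, hS⟩ := ih
        by_cases hex : ∃ d ∈ S, Cset B c = Cset B d
        · obtain ⟨d, hd, hcd⟩ := hex
          refine ⟨p, hp, hfp, ?_⟩
          intro e he
          rcases Finset.mem_insert.1 he with rfl | he
          · rw [hcd]; exact hS d hd
          · exact hS e he
        · obtain ⟨g, hg⟩ := poly_glue_ext (Vset D B c) (↑(Cset B c) : Set (Fin n)) p f
          have hlocV : loc (↑(Cset B c) : Set (Fin n)) p ∈ Theta (Dc D B c) (Bc B c) :=
            loc_mem hp (hclc c) (fun u v hv h => ⟨h, hv⟩) (fun u v hu hv h => ⟨h, hu, hv⟩)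
          have hq0 : restr (Vset D B c) (loc (↑(Cset B c) : Set (Fin n)) p)
              ∈ Theta (compD D B c) (compB D B c) :=
            restr_mem hlocV
          have hag0 : Agree (↑(Cset B c) : Set (Fin n))
              (extV (Vset D B c) (restr (Vset D B c) (loc (↑(Cset B c) : Set (Fin n)) p))) p :=
            (agree_ext_restr (C_sub_V D B c)
              (fun u v _ hne => (Dc_prop D B c u v (hlocV.1 u v hne)).1)).trans
              (agree_glue _ _ p).symm
          have hgp : glue (↑(Cset B c) : Set (Fin n)) p
              (extV (Vset D B c) (restr (Vset D B c) (loc (↑(Cset B c) : Set (Fin n)) p))) = p := by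
            rw [glue_congr p hag0]
            refine Prod.ext ?_ ?_
            · ext u v; rw [glue_fst, ite_self]
            · ext u v; rw [glue_snd, ite_self]
          have hgne : polyEval g (restr (Vset D B c) (loc (↑(Cset B c) : Set (Fin n)) p)) ≠ 0 := by
            rw [hg, hgp]; exact hfp
          obtain ⟨q, hq, hqfin⟩ : ∃ q ∈ Theta (compD D B c) (compB D B c) \
              {q ∈ Theta (compD D B c) (compB D B c) | polyEval g q = 0},
              (fiber (compD D B c) (compB D B c) q).Finite := by
            by_contra hall
            push Not at hall
            exact hno c ⟨_, ⟨g, ⟨_, hq0, hgne⟩, rfl⟩, hall⟩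
          have hgq : polyEval g q ≠ 0 := fun h => hq.2 ⟨hq.1, h⟩
          have hqe : extV (Vset D B c) q ∈ Theta (Dc D B c) (Bc B c) := ext_mem hq.1
          have hFq : (FC (Dc D B c) (Bc B c) ↑(Cset B c) (extV (Vset D B c) q)).Finite :=
            (fiber_ext (hb2 c) (Dc_prop D B c) (Bc_prop B c) (C_sub_V D B c) hq.1).1 hqfin
          have hp' : glue (↑(Cset B c) : Set (Fin n)) p (extV (Vset D B c) q)
              ∈ Theta (↑D : Set (Fin n × Fin n)) ↑B :=
            glue_mem hp hqe (Cset_closed hG.1 c) (fun u v _ h => h.1) (fun u v _ _ h => h.1)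
          refine ⟨_, hp', ?_, ?_⟩
          · rw [← hg]; exact hgq
          · intro d hd
            rcases Finset.mem_insert.1 hd with rfl | hd
            · exact FC_transfer hqe (hclc d) (fun u v hv h => ⟨h, hv⟩)
                (fun u v hu hv h => ⟨h, hu, hv⟩) (agree_glue _ _ _).symm hFq
            · have hdisj : ∀ v ∈ (↑(Cset B d) : Set (Fin n)), v ∉ (↑(Cset B c) : Set (Fin n)) := by
                rcases Cset_eq_or_disj hG.1 d c with h | h
                · exact absurd ⟨d, hd, h.symm⟩ hex
                · exact h
              refine FC_transfer hp (Cset_closed hG.1 d) (fun _ _ _ h => h)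
                (fun _ _ _ _ h => h) ⟨?_, ?_⟩ (hS d hd)
              · intro u v hv
                rw [glue_fst, if_neg (hdisj v hv)]
              · intro u hu v hv
                rw [glue_snd, if_neg (fun h => hdisj v hv h.2)]
    obtain ⟨p, hp, hfp, hall⟩ := step Finset.univ
    exact hinf p ⟨hp, fun h => hfp h.2⟩
      (fiber_finite_of_FC hG hb1 hp fun c => hall c (Finset.mem_univ c))
  · rintro ⟨c, A, ⟨f, ⟨q0, hq0, hf0⟩, rfl⟩, hinf⟩
    obtain ⟨g, hg⟩ := poly_restr_loc (Vset D B c) (↑(Cset B c) : Set (Fin n)) f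
    have hq0e : extV (Vset D B c) q0 ∈ Theta (Dc D B c) (Bc B c) := ext_mem hq0
    refine ⟨_, ⟨g, ⟨extV (Vset D B c) q0, Theta_mono (hDD c) (hBB c) hq0e, ?_⟩, rfl⟩, ?_⟩
    · rw [hg, loc_of_mem (fun u v h => (Dc_prop D B c u v h).2) (Bc_prop B c) hq0e, restr_ext]
      exact hf0
    · rintro p ⟨hp, hpne⟩ hfin
      have hgp : polyEval g p ≠ 0 := fun h => hpne ⟨hp, h⟩
      rw [hg] at hgp
      have hlocV : loc (↑(Cset B c) : Set (Fin n)) p ∈ Theta (Dc D B c) (Bc B c) :=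
        loc_mem hp (hclc c) (fun u v hv h => ⟨h, hv⟩) (fun u v hu hv h => ⟨h, hu, hv⟩)
      have hq : restr (Vset D B c) (loc (↑(Cset B c) : Set (Fin n)) p)
          ∈ Theta (compD D B c) (compB D B c) := restr_mem hlocV
      refine hinf _ ⟨hq, fun h => hgp h.2⟩ ?_
      refine (fiber_ext (hb2 c) (Dc_prop D B c) (Bc_prop B c) (C_sub_V D B c) hq).2 ?_
      refine FC_transfer hp (Cset_closed hG.1 c) (fun u v _ h => h.1) (fun u v _ _ h => h.1)
        ((agree_ext_restr (C_sub_V D B c)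
              (fun u v _ hne => (Dc_prop D B c u v (hlocV.1 u v hne)).1)).trans
              (agree_glue _ _ p).symm) (hfin.subset ?_)
      rintro r ⟨hr, hgl, hR⟩
      exact ⟨hr, (phi_of_RC hb1 hp hr (Cset_closed hG.1 c) hgl hR).symm⟩
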